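/- arXiv:1811.10472 — 6 statements merged into one kernel-verified Lean document; each statement's English description precedes it below -/
import Mathlib

section
/- For r ∈ {1, κ} let S_r := {(r₃, r₄) ∈ k^× × k^× : there exists t ∈ {1, −1} with t + t⁻¹ = z(r, r₃, r₄)} (equivalently, r·r₄² = −4·r₃³). Then ∑_{(r₃,r₄) ∈ S₁} ψ(r₃) − ∑_{(r₃,r₄) ∈ S_κ} ψ(r₃) = 2·ε₀·g(ψ). (This is twice the quantity B₁⁰ − B_κ⁰ = C₁⁰ − C_κ⁰ = D₁⁰ − D_κ⁰ of the paper's Lemmas A.2, A.4 and A.5, where r₄ runs over k^×/{±1}.) -/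
lemma exists_add_inv_eq_iff {k : Type*} [Field k] (hchar : ringChar k ≠ 2) {r a b : k}
    (hr : r ≠ 0) (ha : a ≠ 0) :
    (b ≠ 0 ∧ ∃ t : k, (t = 1 ∨ t = -1) ∧ t + t⁻¹ = -2 - r * b ^ 2 * (a ^ 3)⁻¹) ↔
      b ^ 2 = -(r * a) * (2 * a * r⁻¹) ^ 2 := by
  have h2 : (2 : k) ≠ 0 := Ring.two_ne_zero hchar
  constructor
  · rintro ⟨hb, t, rfl | rfl, ht⟩
    · field_simp at ht ⊢
      linear_combination ht
    · have h : r * b ^ 2 * (a ^ 3)⁻¹ = 0 := by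
        rw [inv_neg, inv_one] at ht
        linear_combination ht
      simp [hr, hb, ha] at h
  · intro h
    refine ⟨?_, 1, Or.inl rfl, ?_⟩
    · rintro rfl
      simp [hr, ha, h2] at h
    · rw [h]
      field_simp
      ring

section
variable {k : Type*} [Field k] [Fintype k] [DecidableEq k]

lemma card_filter_sq_eq (hchar : ringChar k ≠ 2) (a : k) :
    (((Finset.univ.filter fun x : k => x ^ 2 = a).card : ℕ) : ℂ) =
      ((quadraticChar k a : ℤ) : ℂ) + 1 := by
  have h := quadraticChar_card_sqrts hchar a
  rw [Set.toFinset_ofPred] at h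
  exact_mod_cast h

lemma sum_sq_eq_sum_quadraticChar_mul (hchar : ringChar k ≠ 2) {ψ : AddChar k ℂ} (hψ : ψ ≠ 1) :
    ∑ x : k, ψ (x ^ 2) = ∑ a : k, ((quadraticChar k a : ℤ) : ℂ) * ψ a := by
  have h0 : ∑ a : k, ψ a = 0 := AddChar.sum_eq_zero_iff_ne_zero.2 hψ
  rw [← Finset.sum_fiberwise' Finset.univ (fun x : k => x ^ 2) (fun a => ψ a)]
  simp_rw [Finset.sum_const, nsmul_eq_mul, card_filter_sq_eq hchar, add_mul, one_mul]
  rw [Finset.sum_add_distrib, h0, add_zero]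

lemma sum_filter_exists_add_inv_eq (hchar : ringChar k ≠ 2) (ψ : AddChar k ℂ) {r : k} (hr : r ≠ 0)
    [DecidablePred fun p : k × k => p.1 ≠ 0 ∧ p.2 ≠ 0 ∧
      ∃ t : k, (t = 1 ∨ t = -1) ∧ t + t⁻¹ = -2 - r * p.2 ^ 2 * (p.1 ^ 3)⁻¹] :
    ∑ p ∈ Finset.univ.filter (fun p : k × k => p.1 ≠ 0 ∧ p.2 ≠ 0 ∧
      ∃ t : k, (t = 1 ∨ t = -1) ∧ t + t⁻¹ = -2 - r * p.2 ^ 2 * (p.1 ^ 3)⁻¹), ψ p.1 =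
    ∑ a ∈ Finset.univ.erase (0 : k), (((quadraticChar k (-(r * a)) : ℤ) : ℂ) + 1) * ψ a := by
  have h2 : (2 : k) ≠ 0 := Ring.two_ne_zero hchar
  rw [Finset.sum_filter, Fintype.sum_prod_type, ← Finset.sum_erase (a := (0 : k)) _ (by simp)]
  refine Finset.sum_congr rfl fun a ha => ?_
  have ha0 : a ≠ 0 := Finset.ne_of_mem_erase ha
  have hc : quadraticChar k (-(r * a)) = quadraticChar k (-(r * a) * (2 * a * r⁻¹) ^ 2) := by
    rw [map_mul, quadraticChar_sq_one' (by simp [h2, ha0, hr]), mul_one]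
  rw [hc, ← card_filter_sq_eq hchar, ← nsmul_eq_mul, ← Finset.sum_const, Finset.sum_filter]
  refine Finset.sum_congr rfl fun b _ => if_congr ?_ rfl rfl
  simp only [ha0, ne_eq, not_false_eq_true, true_and]
  exact exists_add_inv_eq_iff hchar hr ha0

end

/- Lemma A.2/A.4/A.5 (the `i = 0` case): with
`z(r, r₃, r₄) = −2 − r·r₄²·r₃⁻³` and
`S_r = {(r₃, r₄) ∈ k^× × k^× : ∃ t ∈ {1, −1}, t + t⁻¹ = z(r, r₃, r₄)}`,
one has `∑_{S₁} ψ(r₃) − ∑_{S_κ} ψ(r₃) = 2·ε₀·g(ψ)`. -/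
open scoped Classical in
theorem gaussSum_B0_diff
    (k : Type) [Field k] [Fintype k] [DecidableEq k]
    (hchar : ringChar k ≠ 2)
    (ψ : AddChar k ℂ) (hψ : ψ ≠ 1)
    (κ : k) (hκ0 : κ ≠ 0) (hκ : ¬ IsSquare κ) :
    (∑ p ∈ Finset.univ.filter (fun p : k × k => p.1 ≠ 0 ∧ p.2 ≠ 0 ∧
        ∃ t : k, (t = 1 ∨ t = -1) ∧ t + t⁻¹ = -2 - 1 * p.2 ^ 2 * (p.1 ^ 3)⁻¹), ψ p.1) -
      (∑ p ∈ Finset.univ.filter (fun p : k × k => p.1 ≠ 0 ∧ p.2 ≠ 0 ∧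
        ∃ t : k, (t = 1 ∨ t = -1) ∧ t + t⁻¹ = -2 - κ * p.2 ^ 2 * (p.1 ^ 3)⁻¹), ψ p.1) =
      2 * ((quadraticChar k (-1) : ℤ) : ℂ) * ∑ x : k, ψ (x ^ 2) := by
  rw [sum_filter_exists_add_inv_eq hchar ψ one_ne_zero, sum_filter_exists_add_inv_eq hchar ψ hκ0,
    sum_sq_eq_sum_quadraticChar_mul hchar hψ,
    ← Finset.sum_erase (a := (0 : k)) (f := fun a => ((quadraticChar k a : ℤ) : ℂ) * ψ a)
      Finset.univ (by simp),
    Finset.mul_sum, ← Finset.sum_sub_distrib]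
  refine Finset.sum_congr rfl fun a _ => ?_
  have h1 : -(1 * a) = -1 * a := by ring
  have h2 : -(κ * a) = -1 * (κ * a) := by ring
  rw [h1, h2, map_mul, map_mul, map_mul, quadraticChar_neg_one_iff_not_isSquare.2 hκ]
  push_cast
  ring
end

section
/- Assume q ≡ 1 (mod 3). For r ∈ {1, κ} let N_r := {(r₃, r₄) ∈ k^× × k^× : there exists t ∈ k^× with t + t⁻¹ = z(r, r₃, r₄) and t is not a cube in k^× (i.e. t ≠ s³ for every s ∈ k^×)}. Then ∑_{(r₃,r₄) ∈ N₁} ψ(r₃) − ∑_{(r₃,r₄) ∈ N_κ} ψ(r₃) = 0. (This is twice the quantity B₁² − B_κ² of the paper's Lemma A.2.) -/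
/-- The map `(t, u) ↦ u * (t + 1)` is two-to-one from the pairs with `t` a noncube and
`e * t * u ^ 2 = -1` onto the `b ≠ 0` for which `t + t⁻¹ = -2 - e * b ^ 2` has a noncube root. -/
theorem card_noncube_pairs {k : Type*} [Field k] [Fintype k] [DecidableEq k] (e : k)
    (P : k → Prop) (hP : ∀ b, P b ↔ b ≠ 0 ∧ ∃ t : k, t ≠ 0 ∧ t + t⁻¹ = -2 - e * b ^ 2 ∧
      ¬ ∃ s : k, s ≠ 0 ∧ t = s ^ 3) [DecidablePred P]
    [DecidablePred fun p : k × k => (p.1 ≠ 0 ∧ ¬ ∃ s : k, s ≠ 0 ∧ p.1 = s ^ 3) ∧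
      e * p.1 * p.2 ^ 2 = -1] :
    (Finset.univ.filter fun p : k × k => (p.1 ≠ 0 ∧ ¬ ∃ s : k, s ≠ 0 ∧ p.1 = s ^ 3) ∧
      e * p.1 * p.2 ^ 2 = -1).card = (Finset.univ.filter P).card * 2 := by
  have ne_neg_one : ∀ t : k, (¬ ∃ s : k, s ≠ 0 ∧ t = s ^ 3) → t + 1 ≠ 0 := fun t ht h =>
    ht ⟨-1, neg_ne_zero.2 one_ne_zero, by linear_combination h⟩
  have ne_one : ∀ t : k, (¬ ∃ s : k, s ≠ 0 ∧ t = s ^ 3) → t - 1 ≠ 0 := fun t ht h =>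
    ht ⟨1, one_ne_zero, by linear_combination h⟩
  have root_iff : ∀ t b : k, t ≠ 0 →
      (t + t⁻¹ = -2 - e * b ^ 2 ↔ (t + 1) ^ 2 = -(e * t * b ^ 2)) := by
    intro t b ht
    constructor
    · intro h
      field_simp at h
      linear_combination h
    · intro h
      field_simp
      linear_combination h
  rw [Finset.card_eq_sum_card_fiberwise (f := fun p : k × k => p.2 * (p.1 + 1))
    (t := Finset.univ.filter P), Finset.sum_const_nat]
  · intro b hb
    rw [Finset.mem_filter, hP] at hb
    obtain ⟨-, hb0, t, ht0, ht, hcube⟩ := hb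
    rw [root_iff t b ht0] at ht
    have h1 := ne_neg_one t hcube
    have h2 := ne_one t hcube
    have hcube' : ¬ ∃ s : k, s ≠ 0 ∧ t⁻¹ = s ^ 3 := fun ⟨s, hs, h⟩ =>
      hcube ⟨s⁻¹, inv_ne_zero hs, by rw [inv_pow, ← h, inv_inv]⟩
    rw [Finset.card_eq_two]
    refine ⟨(t, b / (t + 1)), (t⁻¹, b * t / (t + 1)), ?_, ?_⟩
    · intro h
      have h3 := (Prod.ext_iff.1 h).1
      simp only at h3
      field_simp at h3
      exact mul_ne_zero h1 h2 (by linear_combination h3)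
    · ext ⟨x, u⟩
      simp only [Finset.mem_filter, Finset.mem_univ, true_and, Finset.mem_insert,
        Finset.mem_singleton, Prod.mk.injEq]
      constructor
      · rintro ⟨⟨⟨hx0, hx⟩, hu⟩, rfl⟩
        have h4 : (x - t) * (x * t - 1) = 0 := by
          linear_combination -x * ht + t * (x + 1) ^ 2 * hu
        rcases mul_eq_zero.1 h4 with h | h
        · left
          obtain rfl := sub_eq_zero.1 h
          exact ⟨rfl, by field_simp⟩
        · right
          have hx' : x = t⁻¹ := eq_inv_of_mul_eq_one_left (sub_eq_zero.1 h)
          subst hx'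
          refine ⟨rfl, ?_⟩
          field_simp
          ring
      · rintro (⟨rfl, rfl⟩ | ⟨rfl, rfl⟩)
        · refine ⟨⟨⟨ht0, hcube⟩, ?_⟩, by field_simp⟩
          field_simp
          linear_combination ht
        · refine ⟨⟨⟨inv_ne_zero ht0, hcube'⟩, ?_⟩, ?_⟩
          · field_simp
            linear_combination ht
          · field_simp
            ring
  · rintro ⟨t, u⟩ h
    simp only [Finset.coe_filter, Finset.mem_univ, true_and, Set.mem_ofPred_eq] at h ⊢
    obtain ⟨⟨ht0, ht⟩, hu⟩ := h
    rw [hP]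
    refine ⟨mul_ne_zero ?_ (ne_neg_one t ht), t, ht0, (root_iff _ _ ht0).2 ?_, ht⟩
    · rintro rfl
      simp at hu
    · linear_combination (t + 1) ^ 2 * hu

/-- Scaling `(t, u) ↦ (c⁻³ * t, c * u)` shows that the number of `b ≠ 0` for which
`t + t⁻¹ = -2 - e * b ^ 2` has a noncube root does not change when `e` is multiplied by `c ≠ 0`. -/
theorem card_noncube_root_scale {k : Type*} [Field k] [Fintype k] (e e' c : k)
    (hc : c ≠ 0) (he : e' = c * e) (P P' : k → Prop)
    (hP : ∀ b, P b ↔ b ≠ 0 ∧ ∃ t : k, t ≠ 0 ∧ t + t⁻¹ = -2 - e * b ^ 2 ∧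
      ¬ ∃ s : k, s ≠ 0 ∧ t = s ^ 3)
    (hP' : ∀ b, P' b ↔ b ≠ 0 ∧ ∃ t : k, t ≠ 0 ∧ t + t⁻¹ = -2 - e' * b ^ 2 ∧
      ¬ ∃ s : k, s ≠ 0 ∧ t = s ^ 3) [DecidablePred P] [DecidablePred P'] :
    (Finset.univ.filter P).card = (Finset.univ.filter P').card := by
  classical
  apply Nat.eq_of_mul_eq_mul_right two_pos
  rw [← card_noncube_pairs e P hP, ← card_noncube_pairs e' P' hP']
  subst he
  have cube_mul : ∀ d t : k, d ≠ 0 → (¬ ∃ s : k, s ≠ 0 ∧ t = s ^ 3) →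
      ¬ ∃ s : k, s ≠ 0 ∧ d ^ 3 * t = s ^ 3 := fun d t hd ht ⟨s, hs, h⟩ =>
    ht ⟨s / d, div_ne_zero hs hd, by rw [div_pow, ← h]; field_simp⟩
  refine Finset.card_nbij' (fun p => (c⁻¹ ^ 3 * p.1, c * p.2))
    (fun p => (c ^ 3 * p.1, c⁻¹ * p.2)) ?_ ?_ ?_ ?_
  · rintro ⟨t, u⟩ h
    simp only [Finset.coe_filter, Finset.mem_univ, true_and, Set.mem_ofPred_eq] at h ⊢
    obtain ⟨⟨ht0, ht⟩, hu⟩ := h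
    refine ⟨⟨mul_ne_zero (pow_ne_zero _ (inv_ne_zero hc)) ht0, cube_mul _ _ (inv_ne_zero hc) ht⟩, ?_⟩
    rw [← hu]
    field_simp
  · rintro ⟨t, u⟩ h
    simp only [Finset.coe_filter, Finset.mem_univ, true_and, Set.mem_ofPred_eq] at h ⊢
    obtain ⟨⟨ht0, ht⟩, hu⟩ := h
    refine ⟨⟨mul_ne_zero (pow_ne_zero _ hc) ht0, cube_mul _ _ hc ht⟩, ?_⟩
    rw [← hu]
    field_simp
  · rintro ⟨t, u⟩ -
    ext <;> field_simp
  · rintro ⟨t, u⟩ -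
    ext <;> field_simp


/- Lemma A.2 (the `i = 2` case, `q ≡ 1 mod 3`): with
`z(r, r₃, r₄) = −2 − r·r₄²·r₃⁻³` and
`N_r = {(r₃, r₄) ∈ k^× × k^× : ∃ t ∈ k^×, t + t⁻¹ = z(r, r₃, r₄), t not a cube in k^×}`,
one has `∑_{N₁} ψ(r₃) − ∑_{N_κ} ψ(r₃) = 0`. -/
open scoped Classical in
theorem gaussSum_B2_diff
    (k : Type) [Field k] [Fintype k] [DecidableEq k]
    (hchar : ringChar k ≠ 2)
    (hq : Fintype.card k % 3 = 1)
    (ψ : AddChar k ℂ) (hψ : ψ ≠ 1)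
    (κ : k) (hκ0 : κ ≠ 0) (hκ : ¬ IsSquare κ) :
    (∑ p ∈ Finset.univ.filter (fun p : k × k => p.1 ≠ 0 ∧ p.2 ≠ 0 ∧
        ∃ t : k, t ≠ 0 ∧ t + t⁻¹ = -2 - 1 * p.2 ^ 2 * (p.1 ^ 3)⁻¹ ∧
          ¬ ∃ s : k, s ≠ 0 ∧ t = s ^ 3), ψ p.1) -
      (∑ p ∈ Finset.univ.filter (fun p : k × k => p.1 ≠ 0 ∧ p.2 ≠ 0 ∧
        ∃ t : k, t ≠ 0 ∧ t + t⁻¹ = -2 - κ * p.2 ^ 2 * (p.1 ^ 3)⁻¹ ∧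
          ¬ ∃ s : k, s ≠ 0 ∧ t = s ^ 3), ψ p.1) = 0 := by
  rw [sub_eq_zero, Finset.sum_filter, Finset.sum_filter, Fintype.sum_prod_type,
    Fintype.sum_prod_type]
  refine Finset.sum_congr rfl fun a _ => ?_
  dsimp only
  rw [← Finset.sum_filter, ← Finset.sum_filter, Finset.sum_const, Finset.sum_const]
  by_cases ha : a = 0
  · simp [ha]
  · congr 1
    refine card_noncube_root_scale (a ^ 3)⁻¹ (κ * (a ^ 3)⁻¹) κ hκ0 rfl _ _ ?_ ?_
    · intro b
      rw [one_mul, mul_comm (b ^ 2)]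
      exact and_iff_right ha
    · intro b
      rw [mul_right_comm]
      exact and_iff_right ha
end

section
/- For r ∈ {1, κ} let I_r := {(r₃, r₄) ∈ k^× × k^× : there is no t ∈ k^× with t + t⁻¹ = z(r, r₃, r₄)}. Then ∑_{(r₃,r₄) ∈ I₁} ψ(r₃) − ∑_{(r₃,r₄) ∈ I_κ} ψ(r₃) = (1 − ε₀)·g(ψ). (This is twice B₁³ − B_κ³ of Lemma A.2 when q ≡ 1 mod 3, twice (C₁² + C₁³) − (C_κ² + C_κ³) of Lemma A.4 when q ≡ −1 mod 3, and twice D₁² − D_κ² of Lemma A.5 when the characteristic is 3.) -/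
section QuadraticSums

variable {k : Type*} [Field k]

/-- The polynomial `T² + (2 + u)T + 1` has a root iff its discriminant `u(u + 4)` is a square. -/
lemma exists_add_inv_eq_iff_isSquare (h2 : (2 : k) ≠ 0) (u : k) :
    (∃ t : k, t ≠ 0 ∧ t + t⁻¹ = -2 - u) ↔ IsSquare (u * (u + 4)) := by
  constructor
  · rintro ⟨t, ht, h⟩
    refine ⟨t - t⁻¹, ?_⟩
    obtain rfl : u = -2 - (t + t⁻¹) := by rw [h]; ring
    field_simp
    ring
  · rintro ⟨s, hs⟩
    have hprod : (-2 - u + s) / 2 * ((-2 - u - s) / 2) = 1 := by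
      field_simp
      linear_combination hs
    refine ⟨(-2 - u + s) / 2, left_ne_zero_of_mul_eq_one hprod, ?_⟩
    rw [inv_eq_of_mul_eq_one_right hprod]
    field_simp
    ring

variable [Fintype k] [DecidableEq k]

/-- Substituting `v = a y²` in a sum over `y`. -/
lemma sum_mul_sq_eq_sum_quadraticChar (hchar : ringChar k ≠ 2) (f : k → ℂ) {a : k} (ha : a ≠ 0) :
    ∑ y : k, f (a * y ^ 2) =
      ∑ v : k, f v * (1 + ((quadraticChar k a : ℤ) : ℂ) * ((quadraticChar k v : ℤ) : ℂ)) := by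
  rw [← Finset.sum_fiberwise Finset.univ (fun y : k => a * y ^ 2)]
  refine Finset.sum_congr rfl fun v _ => ?_
  have hset : Finset.univ.filter (fun y : k => a * y ^ 2 = v) =
      (Finset.univ.filter (fun y : k => y ^ 2 = a⁻¹ * v)) := by
    ext y
    simp [eq_inv_mul_iff_mul_eq₀ ha]
  have hcard := quadraticChar_card_sqrts hchar (a⁻¹ * v)
  have hinv : quadraticChar k a⁻¹ = quadraticChar k a := by
    have := quadraticChar_sq_one' (inv_ne_zero ha)
    have h : a⁻¹ = a * a⁻¹ ^ 2 := by field_simp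
    rw [h, map_mul, this, mul_one]
  rw [map_mul, hinv] at hcard
  rw [Finset.sum_congr rfl (g := fun _ => f v) (fun y hy => by rw [(Finset.mem_filter.mp hy).2]),
    Finset.sum_const, hset, nsmul_eq_mul, mul_comm]
  congr 1
  have : (((Finset.univ.filter (fun y : k => y ^ 2 = a⁻¹ * v)).card : ℤ) : ℂ) =
      ((quadraticChar k a * quadraticChar k v + 1 : ℤ) : ℂ) := by
    rw [← hcard]
    congr 3
    ext y
    simp
  push_cast at this
  rw [this, add_comm]

lemma sum_addChar_sq_eq_sum_quadraticChar (hchar : ringChar k ≠ 2) {ψ : AddChar k ℂ} (hψ : ψ ≠ 1) :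
    ∑ x : k, ψ (x ^ 2) = ∑ x : k, ((quadraticChar k x : ℤ) : ℂ) * ψ x := by
  have h := sum_mul_sq_eq_sum_quadraticChar hchar ψ (one_ne_zero (α := k))
  simp only [one_mul, map_one, Int.cast_one, mul_add, mul_one, Finset.sum_add_distrib,
    AddChar.sum_eq_zero_of_ne_one hψ, zero_add] at h
  rw [h]
  exact Finset.sum_congr rfl fun _ _ => mul_comm _ _

lemma quadraticChar_sq_eq_ite (a : k) :
    ((quadraticChar k a : ℤ) : ℂ) ^ 2 = if a = 0 then 0 else 1 := by
  split_ifs with h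
  · simp [h]
  · exact_mod_cast quadraticChar_sq_one h

lemma ite_isSquare_eq_quadraticChar (a : k) [Decidable (IsSquare a)] :
    (if IsSquare a then 0 else 1 : ℂ) =
      (((quadraticChar k a : ℤ) : ℂ) ^ 2 - ((quadraticChar k a : ℤ) : ℂ)) / 2 := by
  by_cases h0 : a = 0
  · simp [h0]
  · by_cases h : IsSquare a
    · simp [h, (quadraticChar_one_iff_isSquare h0).mpr h]
    · simp only [h, if_false, quadraticChar_neg_one_iff_not_isSquare.mpr h]
      norm_num

open scoped Classical in
/-- The sum of `χ(u)` over all `u` for which `u(u + 4)` is a nonsquare. -/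
lemma sum_quadraticChar_of_not_isSquare (hchar : ringChar k ≠ 2) :
    ∑ u : k, (if IsSquare (u * (u + 4)) then 0 else 1 : ℂ) * ((quadraticChar k u : ℤ) : ℂ) =
      (1 - ((quadraticChar k (-1) : ℤ) : ℂ)) / 2 := by
  have h4 : quadraticChar k (4 : k) = 1 := by
    rw [show (4 : k) = 2 ^ 2 by norm_num]
    exact quadraticChar_sq_one' (Ring.two_ne_zero hchar)
  have hm4 : quadraticChar k (-4 : k) = quadraticChar k (-1) := by
    rw [show (-4 : k) = -1 * 4 by norm_num, map_mul, h4, mul_one]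
  have hsum : ∑ u : k, ((quadraticChar k u : ℤ) : ℂ) = 0 := by
    exact_mod_cast congrArg (Int.cast : ℤ → ℂ) (quadraticChar_sum_zero hchar)
  have hshift : ∑ u : k, ((quadraticChar k (u + 4) : ℤ) : ℂ) = 0 := by
    rw [← hsum]
    exact Equiv.sum_comp (Equiv.addRight (4 : k)) fun u => ((quadraticChar k u : ℤ) : ℂ)
  have hterm (u : k) :
      (if IsSquare (u * (u + 4)) then 0 else 1 : ℂ) * ((quadraticChar k u : ℤ) : ℂ) =
        (((quadraticChar k u : ℤ) : ℂ) - (if u = -4 then ((quadraticChar k u : ℤ) : ℂ) else 0) -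
          (((quadraticChar k (u + 4) : ℤ) : ℂ) -
            (if u = 0 then ((quadraticChar k (u + 4) : ℤ) : ℂ) else 0))) / 2 := by
    have hu := quadraticChar_sq_eq_ite u
    have hu4 := quadraticChar_sq_eq_ite (u + 4)
    rw [ite_isSquare_eq_quadraticChar, map_mul, Int.cast_mul]
    simp only [add_eq_zero_iff_eq_neg] at hu4
    have hu3 : ((quadraticChar k u : ℤ) : ℂ) ^ 3 = ((quadraticChar k u : ℤ) : ℂ) := by
      rw [pow_succ, hu]
      split_ifs with h <;> simp [h]
    split_ifs at hu hu4 ⊢ <;> linear_combination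
      ((quadraticChar k (u + 4) : ℤ) : ℂ) ^ 2 / 2 * hu3 -
        ((quadraticChar k (u + 4) : ℤ) : ℂ) / 2 * hu + ((quadraticChar k u : ℤ) : ℂ) / 2 * hu4
  simp only [hterm, ← Finset.sum_div, Finset.sum_sub_distrib, hsum, hshift,
    Finset.sum_ite_eq', Finset.mem_univ, if_true, zero_add, h4, hm4]
  push_cast
  ring

open scoped Classical in
/-- The sum over the pairs attached to `r`, as a sum over the first coordinate and `u`. -/
lemma sum_filter_add_inv_eq (hchar : ringChar k ≠ 2) (ψ : AddChar k ℂ) {r : k} (hr : r ≠ 0) :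
    ∑ p ∈ Finset.univ.filter (fun p : k × k => p.1 ≠ 0 ∧ p.2 ≠ 0 ∧
        ¬ ∃ t : k, t ≠ 0 ∧ t + t⁻¹ = -2 - r * p.2 ^ 2 * (p.1 ^ 3)⁻¹), ψ p.1 =
      ∑ x ∈ Finset.univ.filter (fun x : k => x ≠ 0), ψ x *
        ∑ u : k, (if IsSquare (u * (u + 4)) then 0 else 1 : ℂ) *
          (1 + ((quadraticChar k (r * x) : ℤ) : ℂ) * ((quadraticChar k u : ℤ) : ℂ)) := by
  rw [Finset.sum_filter, ← Finset.univ_product_univ, Finset.sum_product, Finset.sum_filter]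
  refine Finset.sum_congr rfl fun x _ => ?_
  by_cases hx : x = 0
  · simp [hx]
  have ha : r * (x ^ 3)⁻¹ ≠ 0 := mul_ne_zero hr (inv_ne_zero (pow_ne_zero 3 hx))
  have hχ : quadraticChar k (r * (x ^ 3)⁻¹) = quadraticChar k (r * x) := by
    rw [show r * x = r * (x ^ 3)⁻¹ * (x ^ 2) ^ 2 by field_simp, map_mul _ (r * (x ^ 3)⁻¹),
      quadraticChar_sq_one' (pow_ne_zero 2 hx), mul_one]
  rw [if_pos hx, ← hχ,
    ← sum_mul_sq_eq_sum_quadraticChar hchar (fun u => if IsSquare (u * (u + 4)) then 0 else 1) ha,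
    Finset.mul_sum]
  refine Finset.sum_congr rfl fun y _ => ?_
  simp only [exists_add_inv_eq_iff_isSquare (Ring.two_ne_zero hchar), mul_right_comm r _ (x ^ 3)⁻¹]
  by_cases hy : y = 0
  · simp [hy]
  · by_cases hsq : IsSquare (r * (x ^ 3)⁻¹ * y ^ 2 * (r * (x ^ 3)⁻¹ * y ^ 2 + 4)) <;>
      simp [hx, hy, hsq]

end QuadraticSums


/- Lemma A.2/A.4/A.5 (the "irrational `t`" case): with
`z(r, r₃, r₄) = −2 − r·r₄²·r₃⁻³` and
`I_r = {(r₃, r₄) ∈ k^× × k^× : no t ∈ k^× satisfies t + t⁻¹ = z(r, r₃, r₄)}`,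
one has `∑_{I₁} ψ(r₃) − ∑_{I_κ} ψ(r₃) = (1 − ε₀)·g(ψ)`. -/
open scoped Classical in
theorem gaussSum_B3_diff
    (k : Type) [Field k] [Fintype k] [DecidableEq k]
    (hchar : ringChar k ≠ 2)
    (ψ : AddChar k ℂ) (hψ : ψ ≠ 1)
    (κ : k) (hκ0 : κ ≠ 0) (hκ : ¬ IsSquare κ) :
    (∑ p ∈ Finset.univ.filter (fun p : k × k => p.1 ≠ 0 ∧ p.2 ≠ 0 ∧
        ¬ ∃ t : k, t ≠ 0 ∧ t + t⁻¹ = -2 - 1 * p.2 ^ 2 * (p.1 ^ 3)⁻¹), ψ p.1) -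
      (∑ p ∈ Finset.univ.filter (fun p : k × k => p.1 ≠ 0 ∧ p.2 ≠ 0 ∧
        ¬ ∃ t : k, t ≠ 0 ∧ t + t⁻¹ = -2 - κ * p.2 ^ 2 * (p.1 ^ 3)⁻¹), ψ p.1) =
      (1 - ((quadraticChar k (-1) : ℤ) : ℂ)) * ∑ x : k, ψ (x ^ 2) := by
  have hκχ := quadraticChar_neg_one_iff_not_isSquare.mpr hκ
  rw [sum_filter_add_inv_eq hchar ψ one_ne_zero, sum_filter_add_inv_eq hchar ψ hκ0,
    ← Finset.sum_sub_distrib, sum_addChar_sq_eq_sum_quadraticChar hchar hψ, Finset.mul_sum,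
    Finset.sum_filter]
  refine Finset.sum_congr rfl fun x _ => ?_
  by_cases hx : x = 0
  · simp [hx]
  rw [if_pos hx, ← mul_sub, ← Finset.sum_sub_distrib, one_mul, map_mul, hκχ]
  have hS := sum_quadraticChar_of_not_isSquare hchar
  rw [eq_div_iff two_ne_zero] at hS
  rw [← hS, Finset.sum_mul, Finset.sum_mul, Finset.mul_sum]
  refine Finset.sum_congr rfl fun u _ => ?_
  push_cast
  ring
end

section
/- Assume q ≡ −1 (mod 3) and q is odd, and let K be a finite field with q² elements carrying a ring embedding φ : k → K. For r ∈ {1, κ} let C_r³ := {(r₃, r₄) ∈ k^× × k^× : no t ∈ k^× satisfies t + t⁻¹ = z(r, r₃, r₄), and there exists t ∈ K^× with t^{q+1} = 1, t + t⁻¹ = φ(z(r, r₃, r₄)), and t is not a cube in K^×}. Then ∑_{(r₃,r₄) ∈ C₁³} ψ(r₃) − ∑_{(r₃,r₄) ∈ C_κ³} ψ(r₃) = 0. (This is twice the quantity C₁³ − C_κ³ of the paper's Lemma A.4.) -/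
open scoped Classical in
theorem exists_map_eq_of_pow_card_eq {k K : Type*} [Field k] [Fintype k] [Field K]
    (φ : k →+* K) {x : K} (hx : x ^ Fintype.card k = x) : ∃ y, φ y = x := by
  have hne := FiniteField.X_pow_card_sub_X_ne_zero K (Fintype.one_lt_card (α := k))
  have hsub : Finset.univ.image φ ⊆
      (Polynomial.X ^ Fintype.card k - Polynomial.X : Polynomial K).roots.toFinset := by
    intro y hy
    obtain ⟨a, -, rfl⟩ := Finset.mem_image.1 hy
    rw [Multiset.mem_toFinset, Polynomial.mem_roots hne]
    simp [← map_pow, FiniteField.pow_card]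
  have hcard : (Polynomial.X ^ Fintype.card k - Polynomial.X : Polynomial K).roots.toFinset.card
      ≤ (Finset.univ.image φ).card := by
    rw [Finset.card_image_of_injective _ φ.injective, Finset.card_univ]
    refine (Multiset.toFinset_card_le _).trans ((Polynomial.card_roots' _).trans ?_)
    rw [FiniteField.X_pow_card_sub_X_natDegree_eq K Fintype.one_lt_card]
  have hmem : x ∈ Finset.univ.image φ := by
    rw [Finset.eq_of_subset_of_card_le hsub hcard, Multiset.mem_toFinset,
      Polynomial.mem_roots hne]
    simp [hx]
  simpa using hmem

theorem add_pow_card_of_ringHom {k K : Type*} [Field k] [Fintype k] [Field K]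
    (φ : k →+* K) (x y : K) :
    (x + y) ^ Fintype.card k = x ^ Fintype.card k + y ^ Fintype.card k := by
  let := φ.toAlgebra
  exact map_add (FiniteField.frobeniusAlgHom k K) x y

/-- A norm-one element has its trace in the base field. -/
theorem exists_map_eq_add_inv {k K : Type*} [Field k] [Fintype k] [Field K]
    (φ : k →+* K) {t : K} (ht : t ^ (Fintype.card k + 1) = 1) : ∃ z, φ z = t + t⁻¹ := by
  apply exists_map_eq_of_pow_card_eq
  have h : t ^ Fintype.card k = t⁻¹ := eq_inv_of_mul_eq_one_left (by rw [← pow_succ, ht])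
  rw [add_pow_card_of_ringHom φ, inv_pow, h, inv_inv, add_comm]

/-- If `z` is the trace of the norm-one element `t`, then `χ(z + 2)` is `t ^ ((q + 1) / 2)`. -/
theorem quadraticChar_add_two_mul_pow {k K : Type*} [Field k] [Fintype k] [DecidableEq k]
    [Field K] (hchar : ringChar k ≠ 2) (φ : k →+* K) {n : ℕ} (hn : Fintype.card k = 2 * n + 1)
    {t : K} (ht : t ^ (Fintype.card k + 1) = 1) (ht1 : t ≠ -1) {z : k} (hz : φ z = t + t⁻¹) :
    ((quadraticChar k (z + 2) : ℤ) : K) * t ^ (n + 1) = 1 := by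
  have h0 : t ≠ 0 := by rintro rfl; simp at ht
  have h1 : t + 1 ≠ 0 := fun h => ht1 (eq_neg_of_add_eq_zero_left h)
  have hφ : φ (z + 2) = (t + 1) ^ 2 * t⁻¹ := by
    rw [map_add, hz, map_ofNat]
    field_simp
    ring
  have hchi : ((quadraticChar k (z + 2) : ℤ) : K) = ((t + 1) ^ 2 * t⁻¹) ^ n := by
    rw [← map_intCast φ, quadraticChar_eq_pow_of_char_ne_two' hchar, map_pow, hφ]
    congr 1
    omega
  have hfrob : (t + 1) ^ (2 * n) * t = 1 := by
    have h2 : t ^ Fintype.card k = t⁻¹ := eq_inv_of_mul_eq_one_left (by rw [← pow_succ, ht])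
    have h3 := add_pow_card_of_ringHom φ t 1
    rw [h2, one_pow, hn, pow_succ] at h3
    apply mul_right_cancel₀ h1
    rw [mul_right_comm, h3]
    field_simp
    ring
  rw [hchi, mul_pow, ← pow_mul, pow_succ, inv_pow]
  field_simp
  rw [mul_comm, hfrob]

/-- Some cube of norm one is not a square in the norm-one group. -/
theorem exists_cube_pow_eq_neg_one {K : Type*} [Field K] [Fintype K] (hK2 : ringChar K ≠ 2)
    {n : ℕ} (hn : Fintype.card K = (2 * n + 1) ^ 2) :
    ∃ w : K, w ≠ 0 ∧ (w ^ 3) ^ (n + 1) = -1 := by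
  obtain ⟨a, ha⟩ := FiniteField.exists_nonsquare hK2
  have ha0 : a ≠ 0 := by rintro rfl; exact ha ⟨0, by simp⟩
  have h1 : a ^ (Fintype.card K / 2) = -1 :=
    (FiniteField.pow_dichotomy hK2 ha0).resolve_left
      fun h => ha ((FiniteField.isSquare_iff hK2 ha0).2 h)
  have h2 : Fintype.card K / 2 = 2 * n * (n + 1) := by
    rw [hn, show (2 * n + 1) ^ 2 = 2 * (2 * n * (n + 1)) + 1 by ring]
    omega
  refine ⟨a ^ (2 * n), pow_ne_zero _ ha0, ?_⟩
  rw [pow_right_comm, ← pow_mul a, ← h2, h1]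
  norm_num

theorem eq_or_eq_inv_of_add_inv_eq {K : Type*} [Field K] {s t : K} (hs : s ≠ 0) (ht : t ≠ 0)
    (h : s + s⁻¹ = t + t⁻¹) : s = t ∨ s = t⁻¹ := by
  have h1 : (s - t) * (s * t - 1) = 0 := by
    field_simp at h
    linear_combination h
  rcases mul_eq_zero.1 h1 with h2 | h2
  · exact Or.inl (sub_eq_zero.1 h2)
  · exact Or.inr (eq_inv_of_mul_eq_one_left (sub_eq_zero.1 h2))

open scoped Classical in
/-- The quadratic character of `z + 2` sums to zero over the traces `z` of the norm-one elements
that are not cubes. -/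
theorem sum_quadraticChar_trace_noncube {k K : Type*} [Field k] [Fintype k] [DecidableEq k]
    [Field K] [Fintype K] (hchar : ringChar k ≠ 2)
    (hK : Fintype.card K = Fintype.card k ^ 2) (φ : k →+* K) :
    ∑ z : k with ∃ t : K, t ≠ 0 ∧ t ^ (Fintype.card k + 1) = 1 ∧ t + t⁻¹ = φ z ∧
      ¬ ∃ s : K, s ≠ 0 ∧ t = s ^ 3, quadraticChar k (z + 2) = 0 := by
  obtain ⟨n, hn⟩ : ∃ n, Fintype.card k = 2 * n + 1 := by
    have := FiniteField.odd_card_of_char_ne_two hchar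
    exact ⟨Fintype.card k / 2, by omega⟩
  have hK2 : ringChar K ≠ 2 := by
    intro h
    have h1 := FiniteField.even_card_of_char_two h
    rw [hK, hn, Nat.pow_mod] at h1
    simp [Nat.add_mod] at h1
  obtain ⟨w, hw0, hw⟩ := exists_cube_pow_eq_neg_one hK2 (hn ▸ hK)
  have hwnorm : (w ^ 3) ^ (Fintype.card k + 1) = 1 := by
    rw [hn, show 2 * n + 1 + 1 = (n + 1) * 2 by ring, pow_mul, hw]
    norm_num
  set T : Finset K := {t | t ^ (Fintype.card k + 1) = 1 ∧ ¬ ∃ s : K, s ≠ 0 ∧ t = s ^ 3} with hT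
  have hT0 : ∀ t ∈ T, t ≠ 0 := by
    rintro t ht rfl
    simp [hT] at ht
  have hTneg : ∀ t ∈ T, t ≠ -1 := by
    rintro t ht rfl
    exact (Finset.mem_filter.1 ht).2.2 ⟨-1, by simp, by norm_num⟩
  have hTone : ∀ t ∈ T, t ≠ 1 := by
    rintro t ht rfl
    exact (Finset.mem_filter.1 ht).2.2 ⟨1, by simp, by norm_num⟩
  have hTinv : ∀ t ∈ T, t⁻¹ ∈ T := by
    intro t ht
    obtain ⟨-, h1, h2⟩ := Finset.mem_filter.1 ht
    refine Finset.mem_filter.2 ⟨Finset.mem_univ _, by rw [inv_pow, h1, inv_one], ?_⟩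
    rintro ⟨s, hs, h⟩
    exact h2 ⟨s⁻¹, inv_ne_zero hs, by rw [inv_pow, ← h, inv_inv]⟩
  have hTmul : ∀ v : K, v ≠ 0 → (v ^ 3) ^ (Fintype.card k + 1) = 1 → ∀ t ∈ T, v ^ 3 * t ∈ T := by
    intro v hv hvn t ht
    obtain ⟨-, h1, h2⟩ := Finset.mem_filter.1 ht
    refine Finset.mem_filter.2 ⟨Finset.mem_univ _, by rw [mul_pow, h1, hvn, one_mul], ?_⟩
    rintro ⟨s, hs, h⟩
    refine h2 ⟨s * v⁻¹, mul_ne_zero hs (inv_ne_zero hv), ?_⟩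
    rw [mul_pow, ← h]
    field_simp
  have htr : ∀ t : K, ∃ z : k, t ∈ T → φ z = t + t⁻¹ := by
    intro t
    by_cases ht : t ∈ T
    · obtain ⟨z, hz⟩ := exists_map_eq_add_inv φ (Finset.mem_filter.1 ht).2.1
      exact ⟨z, fun _ => hz⟩
    · exact ⟨0, fun h => absurd h ht⟩
  choose tr htr using htr
  have hval : ∀ t ∈ T, ((quadraticChar k (tr t + 2) : ℤ) : K) * t ^ (n + 1) = 1 := fun t ht =>
    quadraticChar_add_two_mul_pow hchar φ hn (Finset.mem_filter.1 ht).2.1 (hTneg t ht) (htr t ht)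
  have hflip : ∀ t ∈ T, quadraticChar k (tr (w ^ 3 * t) + 2) = -quadraticChar k (tr t + 2) := by
    intro t ht
    have h1 := hval t ht
    have h2 := hval _ (hTmul w hw0 hwnorm t ht)
    rw [mul_pow, hw] at h2
    have h3 : ((quadraticChar k (tr (w ^ 3 * t) + 2) : ℤ) : K)
        = ((-quadraticChar k (tr t + 2) : ℤ) : K) := by
      apply mul_right_cancel₀ (pow_ne_zero (n + 1) (hT0 t ht))
      push_cast
      linear_combination h1 - h2
    have hne : ∀ a : k, quadraticChar k a = 0 ∨ quadraticChar k a = 1 ∨ quadraticChar k a = -1 :=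
      fun a => quadraticChar_isQuadratic k a
    have hne2 : (2 : K) ≠ 0 := Ring.two_ne_zero hK2
    rcases hne (tr (w ^ 3 * t) + 2) with ha | ha | ha <;>
      rcases hne (tr t + 2) with hb | hb | hb <;> rw [ha, hb] at h3 <;> rw [ha, hb] <;>
      first
        | rfl
        | (exfalso; norm_num at h3; done)
        | (exfalso; push_cast at h3; exact hne2 (by linear_combination h3))
        | (exfalso; push_cast at h3; exact hne2 (by linear_combination -h3))
  have hTsum : ∑ t ∈ T, quadraticChar k (tr t + 2) = 0 := by
    have hwi : (w⁻¹ ^ 3) ^ (Fintype.card k + 1) = 1 := by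
      rw [inv_pow, inv_pow, hwnorm, inv_one]
    have h := Finset.sum_nbij' (s := T) (t := T) (f := fun t => quadraticChar k (tr (w ^ 3 * t) + 2))
      (g := fun t => quadraticChar k (tr t + 2)) (fun t => w ^ 3 * t) (fun t => w⁻¹ ^ 3 * t)
      (hTmul w hw0 hwnorm) (hTmul _ (inv_ne_zero hw0) hwi)
      (fun t _ => by field_simp) (fun t _ => by field_simp) (fun t _ => rfl)
    rw [Finset.sum_congr rfl hflip, Finset.sum_neg_distrib] at h
    omega
  set P : Finset k := {z | ∃ t : K, t ≠ 0 ∧ t ^ (Fintype.card k + 1) = 1 ∧ t + t⁻¹ = φ z ∧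
      ¬ ∃ s : K, s ≠ 0 ∧ t = s ^ 3} with hP
  have hmaps : ∀ t ∈ T, tr t ∈ P := fun t ht =>
    Finset.mem_filter.2 ⟨Finset.mem_univ _, t, hT0 t ht, (Finset.mem_filter.1 ht).2.1,
      (htr t ht).symm, (Finset.mem_filter.1 ht).2.2⟩
  have hfib : ∀ z ∈ P, ∑ t ∈ T with tr t = z, quadraticChar k (tr t + 2)
      = 2 * quadraticChar k (z + 2) := by
    intro z hz
    obtain ⟨-, t, h0, h1, h2, h3⟩ := Finset.mem_filter.1 hz
    have ht : t ∈ T := Finset.mem_filter.2 ⟨Finset.mem_univ _, h1, h3⟩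
    have hpair : {s ∈ T | tr s = z} = {t, t⁻¹} := by
      ext s
      rw [Finset.mem_filter, Finset.mem_insert, Finset.mem_singleton]
      constructor
      · rintro ⟨hs, rfl⟩
        rw [htr s hs] at h2
        exact eq_or_eq_inv_of_add_inv_eq (hT0 s hs) h0 h2.symm
      · rintro (rfl | rfl)
        · exact ⟨ht, φ.injective ((htr _ ht).trans h2)⟩
        · refine ⟨hTinv t ht, φ.injective ((htr _ (hTinv t ht)).trans ?_)⟩
          rw [inv_inv, add_comm, h2]
    have hne : t ≠ t⁻¹ := by
      intro h
      have h4 : t * t = 1 := by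
        nth_rewrite 2 [h]
        exact mul_inv_cancel₀ h0
      rcases mul_self_eq_one_iff.1 h4 with h5 | h5
      · exact hTone t ht h5
      · exact hTneg t ht h5
    rw [Finset.sum_congr rfl (g := fun _ => quadraticChar k (z + 2))
      (fun s hs => by rw [(Finset.mem_filter.1 hs).2]), Finset.sum_const, hpair,
      Finset.card_pair hne]
    simp
  rw [← Finset.sum_fiberwise_of_maps_to hmaps, Finset.sum_congr rfl hfib, ← Finset.mul_sum]
    at hTsum
  omega

open scoped Classical in
/-- If `χ(z + 2)` sums to zero over a set of values `z`, then the exponential sum over the pairs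
`(x, y)` with `-2 - r y² x⁻³` in that set does not depend on `r`. -/
theorem sum_filter_neg_two_sub {k : Type*} [Field k] [Fintype k] [DecidableEq k]
    (hchar : ringChar k ≠ 2) (ψ : k → ℂ) {r : k} (hr : r ≠ 0) (P : k → Prop) (hP : ¬ P (-2))
    (hsum : ∑ z : k with P z, quadraticChar k (z + 2) = 0) :
    ∑ p : k × k with p.1 ≠ 0 ∧ p.2 ≠ 0 ∧ P (-2 - r * p.2 ^ 2 * (p.1 ^ 3)⁻¹), ψ p.1
      = ∑ x : k with x ≠ 0, (Finset.card {z | P z} : ℂ) * ψ x := by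
  rw [Finset.sum_filter, Fintype.sum_prod_type, Finset.sum_filter]
  refine Finset.sum_congr rfl fun x _ => ?_
  by_cases hx : x = 0
  · simp [hx]
  have hcount : Finset.card {y | P (-2 - r * y ^ 2 * (x ^ 3)⁻¹)} = Finset.card {z | P z} := by
    have hmaps : ∀ y ∈ ({y | P (-2 - r * y ^ 2 * (x ^ 3)⁻¹)} : Finset k),
        -2 - r * y ^ 2 * (x ^ 3)⁻¹ ∈ ({z | P z} : Finset k) := by simp
    have hfib : ∀ z ∈ ({z | P z} : Finset k),
        ((Finset.card {y ∈ ({y | P (-2 - r * y ^ 2 * (x ^ 3)⁻¹)} : Finset k) |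
          -2 - r * y ^ 2 * (x ^ 3)⁻¹ = z} : ℕ) : ℤ)
          = quadraticChar k (z + 2) * quadraticChar k (-(x ^ 3 * r⁻¹)) + 1 := by
      intro z hz
      rw [← map_mul, ← quadraticChar_card_sqrts hchar]
      congr 2
      ext y
      simp only [Finset.mem_filter, Finset.mem_univ, true_and, Set.mem_toFinset, Set.mem_ofPred_eq]
      have hiff : -2 - r * y ^ 2 * (x ^ 3)⁻¹ = z ↔ y ^ 2 = (z + 2) * -(x ^ 3 * r⁻¹) := by
        field_simp
        constructor <;> intro h <;> linear_combination -h
      rw [← hiff]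
      exact ⟨fun h => h.2, fun h => ⟨h ▸ (Finset.mem_filter.1 hz).2, h⟩⟩
    have h := congrArg (Nat.cast : ℕ → ℤ) (Finset.card_eq_sum_card_fiberwise hmaps)
    rw [Nat.cast_sum, Finset.sum_congr rfl hfib, Finset.sum_add_distrib, ← Finset.sum_mul, hsum]
      at h
    simpa using h
  dsimp only
  rw [if_pos hx, ← hcount, ← Finset.sum_filter, Finset.sum_const, nsmul_eq_mul]
  congr 3
  ext y
  simp only [Finset.mem_filter, Finset.mem_univ, true_and]
  refine ⟨fun h => h.2.2, fun h => ⟨hx, ?_, h⟩⟩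
  rintro rfl
  exact hP (by simpa using h)

/-- A non-cube of norm one does not have the trace of an element of the base field. -/
theorem add_inv_ne_of_trace_noncube {k K : Type*} [Field k] [Fintype k] [Field K] (φ : k →+* K)
    {z : k} (h : ∃ t : K, t ≠ 0 ∧ t ^ (Fintype.card k + 1) = 1 ∧ t + t⁻¹ = φ z ∧
      ¬ ∃ s : K, s ≠ 0 ∧ t = s ^ 3) : ¬ ∃ t : k, t ≠ 0 ∧ t + t⁻¹ = z := by
  rintro ⟨s, hs, rfl⟩
  obtain ⟨t, ht0, ht1, ht2, ht3⟩ := h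
  rw [map_add, map_inv₀] at ht2
  have hmem : ∃ a : k, φ a = t := by
    rcases eq_or_eq_inv_of_add_inv_eq ht0 (by simpa using hs) ht2 with h | h
    · exact ⟨s, h.symm⟩
    · exact ⟨s⁻¹, by rw [map_inv₀, h]⟩
  obtain ⟨a, rfl⟩ := hmem
  rw [pow_succ, ← map_pow, FiniteField.pow_card] at ht1
  rcases mul_self_eq_one_iff.1 ht1 with h | h
  · exact ht3 ⟨1, one_ne_zero, by simpa using h⟩
  · exact ht3 ⟨-1, by simp, by rw [h]; norm_num⟩

/- Lemma A.4 (the `i = 3` case, `q ≡ −1 mod 3`): with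
`z(r, r₃, r₄) = −2 − r·r₄²·r₃⁻³`, `K` the quadratic extension of `k` via `φ : k → K`, and
`C_r³ = {(r₃, r₄) ∈ k^× × k^× : no t ∈ k^× with t + t⁻¹ = z, and some norm-one
t ∈ K^× with t + t⁻¹ = φ(z) is not a cube in K^×}`,
one has `∑_{C₁³} ψ(r₃) − ∑_{C_κ³} ψ(r₃) = 0`. -/
open scoped Classical in
theorem gaussSum_C3_diff
    (k : Type) [Field k] [Fintype k] [DecidableEq k]
    (hchar : ringChar k ≠ 2)
    (hq : Fintype.card k % 3 = 2)
    (K : Type) [Field K] [Fintype K]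
    (hK : Fintype.card K = Fintype.card k ^ 2)
    (φ : k →+* K)
    (ψ : AddChar k ℂ) (hψ : ψ ≠ 1)
    (κ : k) (hκ0 : κ ≠ 0) (hκ : ¬ IsSquare κ) :
    (∑ p ∈ Finset.univ.filter (fun p : k × k => p.1 ≠ 0 ∧ p.2 ≠ 0 ∧
        (¬ ∃ t : k, t ≠ 0 ∧ t + t⁻¹ = -2 - 1 * p.2 ^ 2 * (p.1 ^ 3)⁻¹) ∧
        ∃ t : K, t ≠ 0 ∧ t ^ (Fintype.card k + 1) = 1 ∧
          t + t⁻¹ = φ (-2 - 1 * p.2 ^ 2 * (p.1 ^ 3)⁻¹) ∧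
          ¬ ∃ s : K, s ≠ 0 ∧ t = s ^ 3), ψ p.1) -
      (∑ p ∈ Finset.univ.filter (fun p : k × k => p.1 ≠ 0 ∧ p.2 ≠ 0 ∧
        (¬ ∃ t : k, t ≠ 0 ∧ t + t⁻¹ = -2 - κ * p.2 ^ 2 * (p.1 ^ 3)⁻¹) ∧
        ∃ t : K, t ≠ 0 ∧ t ^ (Fintype.card k + 1) = 1 ∧
          t + t⁻¹ = φ (-2 - κ * p.2 ^ 2 * (p.1 ^ 3)⁻¹) ∧
          ¬ ∃ s : K, s ≠ 0 ∧ t = s ^ 3), ψ p.1) = 0 := by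
  obtain ⟨P, hP⟩ : ∃ P : k → Prop, ∀ z, P z ↔ (¬ ∃ t : k, t ≠ 0 ∧ t + t⁻¹ = z) ∧
      ∃ t : K, t ≠ 0 ∧ t ^ (Fintype.card k + 1) = 1 ∧ t + t⁻¹ = φ z ∧
        ¬ ∃ s : K, s ≠ 0 ∧ t = s ^ 3 := ⟨_, fun _ => Iff.rfl⟩
  have hsum : ∑ z : k with P z, quadraticChar k (z + 2) = 0 := by
    rw [← sum_quadraticChar_trace_noncube hchar hK φ]
    refine Finset.sum_congr (Finset.filter_congr fun z _ => (hP z).trans ?_) fun _ _ => rfl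
    exact ⟨fun h => h.2, fun h => ⟨add_inv_ne_of_trace_noncube φ h, h⟩⟩
  have hneg : ¬ P (-2) := fun h => ((hP _).1 h).1 ⟨-1, by simp, by norm_num⟩
  simp only [← hP]
  rw [sum_filter_neg_two_sub hchar ψ one_ne_zero P hneg hsum,
    sum_filter_neg_two_sub hchar ψ hκ0 P hneg hsum, sub_self]
end

section
/- Let q be an odd prime power and K a finite field with q² elements. Let t ∈ K^× satisfy t^{q+1} = 1 and t ≠ −1. Then the following are equivalent: (i) there exists a ∈ K with a ≠ 0, a^q = a, and a² = t + t⁻¹ + 2; (ii) there exists β ∈ K with β^{q+1} = 1 and β² = t. (Lemma A.3(2): for a norm-one element t ≠ −1, t + t⁻¹ + 2 is a square in k^× if and only if t is a square in the norm-one subgroup.) -/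
/-- If a finite field has `q ^ 2` elements with `q` a prime power, then `x ↦ x ^ q` is additive. -/
theorem add_pow_of_card_eq_sq {K : Type*} [Field K] [Fintype K] {q : ℕ} (hq : IsPrimePow q)
    (hK : Fintype.card K = q ^ 2) (x y : K) : (x + y) ^ q = x ^ q + y ^ q := by
  obtain ⟨p, n, hp, -, rfl⟩ := hq
  have : Fact p.Prime := ⟨hp.nat_prime⟩
  have : CharP K p := charP_of_card_eq_prime_pow (f := n * 2) (by rw [hK, pow_mul])
  exact add_pow_char_pow x y p n

/- Lemma A.3(2): `q` an odd prime power, `K` a finite field with `q²` elements, and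
`t` a norm-one element of `K^×` with `t ≠ −1`. Then `t + t⁻¹ + 2` is a square in the
subfield `k = {a : a^q = a}` minus 0 iff `t` is a square in the norm-one subgroup. -/
theorem square_in_normOne_iff
    (q : ℕ) (hq : IsPrimePow q) (hodd : Odd q)
    (K : Type) [Field K] [Fintype K] (hK : Fintype.card K = q ^ 2)
    (t : K) (ht0 : t ≠ 0) (ht : t ^ (q + 1) = 1) (htm1 : t ≠ -1) :
    (∃ a : K, a ≠ 0 ∧ a ^ q = a ∧ a ^ 2 = t + t⁻¹ + 2) ↔
      (∃ β : K, β ^ (q + 1) = 1 ∧ β ^ 2 = t) := by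
  have add_pow_q := add_pow_of_card_eq_sq hq hK
  constructor
  · rintro ⟨a, ha0, haq, ha⟩
    have ha' : a ^ 2 * t = (t + 1) ^ 2 := by
      rw [ha]
      field_simp
      ring
    have hnorm : (t + 1) ^ (q + 1) = a ^ 2 := by
      apply mul_right_cancel₀ ht0
      rw [ha', pow_succ, add_pow_q, one_pow]
      linear_combination (t + 1) * ht
    refine ⟨(t + 1) / a, ?_, ?_⟩
    · rw [div_pow, hnorm, pow_succ a q, haq, ← sq, div_self (pow_ne_zero 2 ha0)]
    · rw [div_pow, ← ha', mul_div_cancel_left₀ _ (pow_ne_zero 2 ha0)]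
  · rintro ⟨β, hβ, rfl⟩
    have hβ0 : β ≠ 0 := by
      rintro rfl
      simp at ht0
    have hβq : β ^ q = β⁻¹ := eq_inv_of_mul_eq_one_left (by rw [← pow_succ, hβ])
    refine ⟨β + β⁻¹, ?_, ?_, ?_⟩
    · intro h
      apply htm1
      linear_combination β * h - mul_inv_cancel₀ hβ0
    · rw [add_pow_q, inv_pow, hβq, inv_inv, add_comm]
    · field_simp
      ring
end

section
/- One has (S_α·S_β)³ = −I, and the set {w ∈ W : for every γ ∈ Δ, if w·γ ∈ Φ⁺ then w·γ ∈ Δ} equals {I, −S_α, −S_β, −I}. (The computation in §7.1 of the set B(G₂) of Weyl elements supporting Bessel functions: B(G₂) = {1, w_ℓ s_α, w_ℓ s_β, w_ℓ}, where w_ℓ = (s_α s_β)³ is the long Weyl element of G₂.) -/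
/- §7.1: in the Weyl group `W` of `G₂` (acting on `ℤα ⊕ ℤβ`, generated by the
simple reflections `S_α = [[−1,3],[0,1]]` and `S_β = [[1,0],[1,−1]]` in `GL₂(ℤ)`),
one has `(S_α·S_β)³ = −1`, and the set `B(G₂)` of Weyl elements supporting Bessel
functions equals `{1, −S_α, −S_β, −1}`. -/

open Matrix

/-- The simple reflection `s_α` as an element of `GL₂(ℤ)`. -/
def Sα : GL (Fin 2) ℤ := ⟨!![-1, 3; 0, 1], !![-1, 3; 0, 1], by decide, by decide⟩

/-- The simple reflection `s_β` as an element of `GL₂(ℤ)`. -/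
def Sβ : GL (Fin 2) ℤ := ⟨!![1, 0; 1, -1], !![1, 0; 1, -1], by decide, by decide⟩

/-- The simple roots `{α, β}` of `G₂` in coordinates `(a, b) ↔ aα + bβ`. -/
def Δ : Set (Fin 2 → ℤ) := {![1, 0], ![0, 1]}

/-- The positive roots of `G₂` in coordinates `(a, b) ↔ aα + bβ`. -/
def Φpos : Set (Fin 2 → ℤ) :=
  {![1, 0], ![0, 1], ![1, 1], ![2, 1], ![3, 1], ![3, 2]}

/-- The twelve elements of the Weyl group of `G₂`, written with reduced words up to sign. -/
def weylElements : Finset (GL (Fin 2) ℤ) :=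
  {1, -1, Sα, -Sα, Sβ, -Sβ, Sα * Sβ, -(Sα * Sβ), Sβ * Sα, -(Sβ * Sα),
    Sα * Sβ * Sα, -(Sα * Sβ * Sα)}

theorem simple_mul_mem_weylElements :
    ∀ w ∈ weylElements, Sα * w ∈ weylElements ∧ Sβ * w ∈ weylElements := by
  decide

theorem inv_Sα : Sα⁻¹ = Sα := by decide

theorem inv_Sβ : Sβ⁻¹ = Sβ := by decide

theorem mem_weylElements_of_mem_closure {w : GL (Fin 2) ℤ}
    (hw : w ∈ Subgroup.closure {Sα, Sβ}) : w ∈ weylElements := by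
  induction hw using Subgroup.closure_induction_left with
  | one => decide
  | mul_left x hx y _ ih =>
    rcases hx with rfl | rfl
    · exact (simple_mul_mem_weylElements y ih).1
    · exact (simple_mul_mem_weylElements y ih).2
  | inv_mul_cancel x hx y _ ih =>
    rcases hx with rfl | rfl
    · exact inv_Sα ▸ (simple_mul_mem_weylElements y ih).1
    · exact inv_Sβ ▸ (simple_mul_mem_weylElements y ih).2

theorem Sα_mul_Sβ_pow_three : (Sα * Sβ) ^ 3 = -1 := by decide

theorem neg_mem_closure {w : GL (Fin 2) ℤ} (hw : w ∈ Subgroup.closure {Sα, Sβ}) :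
    -w ∈ Subgroup.closure {Sα, Sβ} := by
  rw [← neg_one_mul, ← Sα_mul_Sβ_pow_three]
  exact mul_mem (pow_mem (mul_mem (Subgroup.subset_closure (by simp))
    (Subgroup.subset_closure (by simp))) 3) hw

theorem supports_bessel_iff_of_mem_weylElements : ∀ w ∈ weylElements,
    ((∀ γ ∈ Δ, (w : Matrix (Fin 2) (Fin 2) ℤ).mulVec γ ∈ Φpos →
      (w : Matrix (Fin 2) (Fin 2) ℤ).mulVec γ ∈ Δ) ↔
        w ∈ ({1, -Sα, -Sβ, -1} : Set (GL (Fin 2) ℤ))) := by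
  simp only [Δ, Φpos, Set.mem_insert_iff, Set.mem_singleton_iff, forall_eq_or_imp, forall_eq]
  decide

theorem weyl_supporting_bessel :
    (Sα * Sβ) ^ 3 = -1 ∧
      {w : GL (Fin 2) ℤ | w ∈ Subgroup.closure {Sα, Sβ} ∧
          ∀ γ ∈ Δ, (w : Matrix (Fin 2) (Fin 2) ℤ).mulVec γ ∈ Φpos →
            (w : Matrix (Fin 2) (Fin 2) ℤ).mulVec γ ∈ Δ} =
        {1, -Sα, -Sβ, -1} := by
  refine ⟨Sα_mul_Sβ_pow_three, Set.ext fun w => ⟨fun ⟨hw, h⟩ =>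
    (supports_bessel_iff_of_mem_weylElements w (mem_weylElements_of_mem_closure hw)).1 h,
    fun h => ?_⟩⟩
  have hw : w ∈ Subgroup.closure {Sα, Sβ} := by
    rcases h with rfl | rfl | rfl | rfl
    · exact one_mem _
    · exact neg_mem_closure (Subgroup.subset_closure (by simp))
    · exact neg_mem_closure (Subgroup.subset_closure (by simp))
    · exact neg_mem_closure (one_mem _)
  exact ⟨hw,
    (supports_bessel_iff_of_mem_weylElements w (mem_weylElements_of_mem_closure hw)).2 h⟩
end
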